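/- arXiv:2306.01335 — 13 statements merged into one kernel-verified Lean document; each statement's English description precedes it below -/
import Mathlib

section
/- Let X and Y be real Hilbert spaces and Ã : X → Y a bounded linear operator with ‖Ã‖ ≤ 1. Let L ∈ [0,1), let f : X → X be Lipschitz continuous with Lipschitz constant L, and set φ(x) = x − f(x). Let x† ∈ X, y = Ã x†, and y^δ ∈ Y with ‖y^δ − y‖ ≤ δ. If x_δ ∈ X satisfies φ(x_δ) = Ã*(y^δ), then ‖x_δ − x†‖ ≤ δ/(1−L) + (1/(1−L)) ‖Ã*Ã x† − φ(x†)‖. -/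
/-- A Lipschitz perturbation of the identity with constant `L` expands distances by at least
`1 - L`. -/
theorem one_sub_mul_norm_sub_le_norm_sub_residual {E : Type*} [SeminormedAddCommGroup E]
    {L : ℝ} {f : E → E} (hf : ∀ x y : E, ‖f x - f y‖ ≤ L * ‖x - y‖) (x y : E) :
    (1 - L) * ‖x - y‖ ≤ ‖(x - f x) - (y - f y)‖ := by
  have h := norm_sub_norm_le (x - y) (f x - f y)
  rw [sub_sub_sub_comm] at h
  linarith [hf x y]

/-- Stability estimate for the iResNet reconstruction: if `φ(x_δ) = Ã*(y^δ)` with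
`‖y^δ − Ã x†‖ ≤ δ`, then `‖x_δ − x†‖ ≤ δ/(1−L) + (1/(1−L)) ‖Ã*Ã x† − φ(x†)‖`. -/
theorem iResNet_stability_estimate
    {X Y : Type*} [NormedAddCommGroup X] [InnerProductSpace ℝ X] [CompleteSpace X]
    [NormedAddCommGroup Y] [InnerProductSpace ℝ Y] [CompleteSpace Y]
    (A : X →L[ℝ] Y) (hA : ‖A‖ ≤ 1)
    (L : ℝ) (hL0 : 0 ≤ L) (hL1 : L < 1)
    (f : X → X) (hf : ∀ x y : X, ‖f x - f y‖ ≤ L * ‖x - y‖)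
    (xdag : X) (δ : ℝ) (ydel : Y) (hy : ‖ydel - A xdag‖ ≤ δ)
    (xdel : X) (hxdel : xdel - f xdel = ContinuousLinearMap.adjoint A ydel) :
    ‖xdel - xdag‖ ≤ δ / (1 - L) +
      (1 / (1 - L)) * ‖ContinuousLinearMap.adjoint A (A xdag) - (xdag - f xdag)‖ := by
  have hexp := one_sub_mul_norm_sub_le_norm_sub_residual hf xdel xdag
  have hnoise : ‖ContinuousLinearMap.adjoint A (ydel - A xdag)‖ ≤ δ := by
    refine le_trans ?_ hy
    have hadj : ‖ContinuousLinearMap.adjoint A‖ ≤ 1 :=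
      (LinearIsometryEquiv.norm_map ContinuousLinearMap.adjoint A).trans_le hA
    simpa using (ContinuousLinearMap.adjoint A).le_of_opNorm_le hadj (ydel - A xdag)
  rw [map_sub] at hnoise
  have htri := norm_sub_le_norm_sub_add_norm_sub (ContinuousLinearMap.adjoint A ydel)
    (ContinuousLinearMap.adjoint A (A xdag)) (xdag - f xdag)
  rw [hxdel] at hexp
  rw [one_div_mul_eq_div, ← add_div, le_div_iff₀ (sub_pos.2 hL1)]
  linarith
end

section
/- Let X and Y be real Hilbert spaces and Ã : X → Y a bounded linear operator with ‖Ã‖ ≤ 1. For each L ∈ [0,1) let f_L : X → X be Lipschitz continuous with Lipschitz constant at most L and set φ_L(x) = x − f_L(x). Let x† ∈ X, y = Ã x†, and suppose there exist an index function ψ, a constant C > 0 and L₀ ∈ [0,1) such that ‖Ã*Ã x† − φ_L(x†)‖ ≤ C (1−L) ψ(1−L) for all L ∈ [L₀, 1). Let L : (0,∞) → [0,1) be a parameter choice with L(δ) → 1 and δ/(1−L(δ)) → 0 as δ → 0. Then for any choice of noisy data y^δ ∈ Y with ‖y^δ − y‖ ≤ δ, the reconstructions x^δ := φ_{L(δ)}⁻¹(Ã*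 y^δ), i.e., the unique x^δ with φ_{L(δ)}(x^δ) = Ã*(y^δ), satisfy ‖x^δ − x†‖ → 0 as δ → 0. -/
open scoped Topology

/-- An index function is continuous, strictly increasing on `[0,∞)`, nonnegative,
and vanishes at `0`. -/
def IsIndexFunction (ψ : ℝ → ℝ) : Prop :=
  ContinuousOn ψ (Set.Ici 0) ∧ StrictMonoOn ψ (Set.Ici 0) ∧ ψ 0 = 0 ∧
    ∀ t ∈ Set.Ici (0 : ℝ), 0 ≤ ψ t

/-- Convergence of the iResNet reconstruction under the local approximation property
and the a priori parameter choice `L(δ) → 1`, `δ/(1−L(δ)) → 0`. -/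
theorem iResNet_convergence
    {X Y : Type*} [NormedAddCommGroup X] [InnerProductSpace ℝ X] [CompleteSpace X]
    [NormedAddCommGroup Y] [InnerProductSpace ℝ Y] [CompleteSpace Y]
    (A : X →L[ℝ] Y) (hA : ‖A‖ ≤ 1)
    (f : ℝ → X → X)
    (hf : ∀ L ∈ Set.Ico (0 : ℝ) 1, ∀ x y : X, ‖f L x - f L y‖ ≤ L * ‖x - y‖)
    (xdag : X)
    (happrox : ∃ ψ : ℝ → ℝ, IsIndexFunction ψ ∧ ∃ C > (0 : ℝ), ∃ L₀ ∈ Set.Ico (0 : ℝ) 1,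
      ∀ L ∈ Set.Ico L₀ 1,
        ‖ContinuousLinearMap.adjoint A (A xdag) - (xdag - f L xdag)‖ ≤ C * (1 - L) * ψ (1 - L))
    (Lc : ℝ → ℝ) (hLc : ∀ δ > (0 : ℝ), Lc δ ∈ Set.Ico (0 : ℝ) 1)
    (hLc1 : Filter.Tendsto Lc (𝓝[>] (0 : ℝ)) (𝓝 1))
    (hLc2 : Filter.Tendsto (fun δ => δ / (1 - Lc δ)) (𝓝[>] (0 : ℝ)) (𝓝 0))
    (ydel : ℝ → Y) (xdel : ℝ → X)
    (hy : ∀ δ > (0 : ℝ), ‖ydel δ - A xdag‖ ≤ δ)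
    (hx : ∀ δ > (0 : ℝ), xdel δ - f (Lc δ) (xdel δ) = ContinuousLinearMap.adjoint A (ydel δ)) :
    Filter.Tendsto (fun δ => ‖xdel δ - xdag‖) (𝓝[>] (0 : ℝ)) (𝓝 0) := by
  obtain ⟨ψ, ⟨hψc, -, hψ0, -⟩, C, -, L₀, hL₀, happ⟩ := happrox
  have hψ : Filter.Tendsto (fun δ => ψ (1 - Lc δ)) (𝓝[>] (0 : ℝ)) (𝓝 0) := by
    have h := hψc 0 Set.self_mem_Ici
    rw [ContinuousWithinAt, hψ0] at h
    refine h.comp (tendsto_nhdsWithin_iff.2 ⟨by simpa using hLc1.const_sub 1, ?_⟩)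
    filter_upwards [self_mem_nhdsWithin] with δ hδ
    exact sub_nonneg.2 (hLc δ hδ).2.le
  have hbound : Filter.Tendsto (fun δ => δ / (1 - Lc δ) + C * ψ (1 - Lc δ))
      (𝓝[>] (0 : ℝ)) (𝓝 0) := by
    simpa using hLc2.add (hψ.const_mul C)
  refine squeeze_zero' (.of_forall fun _ => norm_nonneg _) ?_ hbound
  filter_upwards [self_mem_nhdsWithin, hLc1.eventually (lt_mem_nhds hL₀.2)] with δ hδ hLδ
  have hL := hLc δ hδ
  have hpos : 0 < 1 - Lc δ := sub_pos.2 hL.2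
  have hmodel := happ (Lc δ) ⟨hLδ.le, hL.2⟩
  have hdata : ‖ContinuousLinearMap.adjoint A (ydel δ - A xdag)‖ ≤ δ := by
    refine (ContinuousLinearMap.le_of_opNorm_le _ ?_ _).trans ((one_mul _).trans_le (hy δ hδ))
    rwa [LinearIsometryEquiv.norm_map]
  have hlip := hf (Lc δ) hL (xdel δ) xdag
  have hsplit : xdel δ - xdag = (f (Lc δ) (xdel δ) - f (Lc δ) xdag) +
      ContinuousLinearMap.adjoint A (ydel δ - A xdag) +
      (ContinuousLinearMap.adjoint A (A xdag) - (xdag - f (Lc δ) xdag)) := by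
    rw [map_sub, ← hx δ hδ]
    abel
  have htri := norm_add₃_le (a := f (Lc δ) (xdel δ) - f (Lc δ) xdag)
    (b := ContinuousLinearMap.adjoint A (ydel δ - A xdag))
    (c := ContinuousLinearMap.adjoint A (A xdag) - (xdag - f (Lc δ) xdag))
  rw [← hsplit] at htri
  rw [← mul_le_mul_iff_right₀ hpos, mul_add, mul_div_cancel₀ _ hpos.ne']
  linarith
end

section
/- Let X and Y be real Hilbert spaces and Ã : X → Y a bounded linear operator with ‖Ã‖ ≤ 1. For each L ∈ [0,1) let f_L : X → X be Lipschitz continuous with Lipschitz constant at most L and set φ_L(x) = x − f_L(x). Let x† ∈ X, y = Ã x†, ε > 0, and suppose there exist C > 0 and L₀ ∈ [0,1) such that ‖Ã*Ã x† − φ_L(x†)‖ ≤ C (1−L)^{1+ε} for all L ∈ [L₀, 1). Suppose the parameter choice L : (0,∞) → [0,1) satisfies c₁ δ^{1/(1+ε)} ≤ 1 − L(δ) ≤ c₂ δ^{1/(1+ε)} for constants 0 < c₁ ≤ c₂ and all sufficiently small δ > 0. Then there exist C' > 0 and δ₀ > 0 such that for all δ ∈ (0, δ₀) and all y^δ ∈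 Y with ‖y^δ − y‖ ≤ δ, the unique x^δ with φ_{L(δ)}(x^δ) = Ã*(y^δ) satisfies ‖x^δ − x†‖ ≤ C' δ^{ε/(1+ε)}. -/
open scoped Topology

/-- A map `x - g x` with `g` Lipschitz of constant `L < 1` expands distances by at least `1 - L`. -/
theorem one_sub_mul_norm_sub_le {X : Type*} [NormedAddCommGroup X] {g : X → X} {L : ℝ}
    (hg : ∀ x y : X, ‖g x - g y‖ ≤ L * ‖x - y‖) (x y : X) :
    (1 - L) * ‖x - y‖ ≤ ‖(x - g x) - (y - g y)‖ := by
  have h := norm_sub_norm_le (x - y) (g x - g y)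
  rw [show x - y - (g x - g y) = (x - g x) - (y - g y) by abel] at h
  linarith [hg x y]

/-- Convergence rate `O(δ^{ε/(1+ε)})` for the iResNet reconstruction when the local
approximation property holds with index function `ψ(λ) = λ^ε` and the parameter choice
satisfies `1 − L(δ) ∼ δ^{1/(1+ε)}`. -/
theorem iResNet_convergence_rate
    {X Y : Type*} [NormedAddCommGroup X] [InnerProductSpace ℝ X] [CompleteSpace X]
    [NormedAddCommGroup Y] [InnerProductSpace ℝ Y] [CompleteSpace Y]
    (A : X →L[ℝ] Y) (hA : ‖A‖ ≤ 1)
    (f : ℝ → X → X)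
    (hf : ∀ L ∈ Set.Ico (0 : ℝ) 1, ∀ x y : X, ‖f L x - f L y‖ ≤ L * ‖x - y‖)
    (xdag : X) (ε : ℝ) (hε : 0 < ε)
    (happrox : ∃ C > (0 : ℝ), ∃ L₀ ∈ Set.Ico (0 : ℝ) 1, ∀ L ∈ Set.Ico L₀ 1,
      ‖ContinuousLinearMap.adjoint A (A xdag) - (xdag - f L xdag)‖ ≤ C * (1 - L) ^ (1 + ε))
    (Lc : ℝ → ℝ) (hLc : ∀ δ > (0 : ℝ), Lc δ ∈ Set.Ico (0 : ℝ) 1)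
    (c₁ c₂ : ℝ) (hc₁ : 0 < c₁) (hc₁₂ : c₁ ≤ c₂)
    (δ₁ : ℝ) (hδ₁ : 0 < δ₁)
    (hparam : ∀ δ ∈ Set.Ioo (0 : ℝ) δ₁,
      c₁ * δ ^ ((1 : ℝ) / (1 + ε)) ≤ 1 - Lc δ ∧ 1 - Lc δ ≤ c₂ * δ ^ ((1 : ℝ) / (1 + ε))) :
    ∃ C' > (0 : ℝ), ∃ δ₀ > (0 : ℝ), ∀ δ ∈ Set.Ioo (0 : ℝ) δ₀, ∀ ydel : Y,
      ‖ydel - A xdag‖ ≤ δ → ∀ xdel : X,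
        xdel - f (Lc δ) xdel = ContinuousLinearMap.adjoint A ydel →
          ‖xdel - xdag‖ ≤ C' * δ ^ (ε / (1 + ε)) := by
  obtain ⟨C, hC, L₀, hL₀, happrox⟩ := happrox
  have hc₂ : 0 < c₂ := hc₁.trans_le hc₁₂
  have hε' : 0 < 1 + ε := by linarith
  have hq : 0 < (1 - L₀) / c₂ := div_pos (by linarith [hL₀.2]) hc₂
  refine ⟨1 / c₁ + C * c₂ ^ ε, by positivity, min δ₁ (((1 - L₀) / c₂) ^ (1 + ε)),
    lt_min hδ₁ (Real.rpow_pos_of_pos hq _), ?_⟩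
  rintro δ ⟨hδ, hδ₀⟩ ydel hy xdel hx
  obtain ⟨hlow, hup⟩ := hparam δ ⟨hδ, hδ₀.trans_le (min_le_left _ _)⟩
  set t : ℝ := δ ^ ((1 : ℝ) / (1 + ε)) with ht
  have htpos : 0 < t := Real.rpow_pos_of_pos hδ _
  have htε : δ ^ (ε / (1 + ε)) = t ^ ε := by
    rw [ht, ← Real.rpow_mul hδ.le, one_div_mul_eq_div]
  have htδ : δ = t * t ^ ε := by
    rw [← Real.rpow_one_add' htpos.le hε'.ne', ht, ← Real.rpow_mul hδ.le,
      one_div_mul_cancel hε'.ne', Real.rpow_one]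
  have htq : t ≤ (1 - L₀) / c₂ := by
    rw [ht, one_div, Real.rpow_inv_le_iff_of_pos hδ.le hq.le hε']
    exact (hδ₀.trans_le (min_le_right _ _)).le
  have hL : L₀ ≤ Lc δ := by
    rw [le_div_iff₀ hc₂] at htq
    linarith
  have hLδ := hLc δ hδ
  set s : ℝ := 1 - Lc δ with hs
  have hspos : 0 < s := by linarith [hLδ.2]
  have hdata : ‖ContinuousLinearMap.adjoint A (ydel - A xdag)‖ ≤ δ := by
    refine (ContinuousLinearMap.le_opNorm _ _).trans ?_
    rw [LinearIsometryEquiv.norm_map]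
    exact (mul_le_of_le_one_left (norm_nonneg _) hA).trans hy
  have hmodel := happrox (Lc δ) ⟨hL, hLδ.2⟩
  rw [← hs, Real.rpow_one_add' hspos.le hε'.ne'] at hmodel
  have hsε : s ^ ε ≤ c₂ ^ ε * t ^ ε := by
    rw [← Real.mul_rpow hc₂.le htpos.le]
    exact Real.rpow_le_rpow hspos.le hup hε.le
  have hexpand := one_sub_mul_norm_sub_le (hf (Lc δ) hLδ) xdel xdag
  have hsplit : (xdel - f (Lc δ) xdel) - (xdag - f (Lc δ) xdag) =
      ContinuousLinearMap.adjoint A (ydel - A xdag) +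
        (ContinuousLinearMap.adjoint A (A xdag) - (xdag - f (Lc δ) xdag)) := by
    rw [hx, map_sub]
    abel
  rw [hsplit, ← hs] at hexpand
  have hnorm := hexpand.trans (norm_add_le_of_le hdata hmodel)
  have hts : t ≤ s * (1 / c₁) := by
    rw [mul_one_div, le_div_iff₀ hc₁]
    linarith
  rw [htε]
  refine le_of_mul_le_mul_left ?_ hspos
  calc s * ‖xdel - xdag‖ ≤ δ + C * (s * s ^ ε) := hnorm
    _ = t * t ^ ε + C * (s * s ^ ε) := by rw [← htδ]
    _ ≤ s * (1 / c₁) * t ^ ε + C * (s * (c₂ ^ ε * t ^ ε)) := by gcongr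
    _ = s * ((1 / c₁ + C * c₂ ^ ε) * t ^ ε) := by ring
end

section
/- Assume the SVD setting. For L ∈ [0,1) let r̂_L : [0,1] → ℝ be a function with sup_j |r̂_L(σ_j²)| < ∞ and let b̂_L ∈ X, and define T_L : Y → X by T_L(y) = b̂_L + Σ_{j∈ℕ} r̂_L(σ_j²) σ_j ⟨y, u_j⟩ v_j. Suppose: (i) for every j, r̂_L(σ_j²) → 1/σ_j² as L → 1; (ii) there is C > 0 with σ_j² |r̂_L(σ_j²)| ≤ C for all j and all L ∈ [0,1); (iii) ‖b̂_L‖ → 0 as L → 1. Let x† ∈ X lie in the closed linear span of {v_j : j ∈ ℕ} and set y = Ã x†. Let L : (0,∞) → [0,1) be a parameter choice such that L(δ) → 1 and δ · sqrt( sup_j |r̂_{L(δ)}(σ_j²)| ) → 0 as δ → 0. Then for any y^δ ∈ Y with ‖y^δ − y‖ ≤ δ, we have ‖T_{L(δ)}(y^δ) − x†‖ → 0 as δ → 0. -/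
open scoped Topology RealInnerProductSpace

section OrthonormalSeries

variable {ι E : Type*} [NormedAddCommGroup E] [InnerProductSpace ℝ E] {v : ι → E}

theorem Orthonormal.inner_eq_of_hasSum_smul (hv : Orthonormal ℝ v) {c : ι → ℝ} {z : E}
    (h : HasSum (fun j => c j • v j) z) (k : ι) : ⟪z, v k⟫ = c k := by
  classical
  have h1 : HasSum (fun j => ⟪v k, c j • v j⟫) ⟪v k, z⟫ := h.mapL (innerSL ℝ (v k))
  have h2 : HasSum (fun j => ⟪v k, c j • v j⟫) (c k) := by
    convert hasSum_ite_eq k (c k) using 2 with j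
    rw [inner_smul_right, orthonormal_iff_ite.mp hv]
    by_cases hj : j = k
    · simp [hj]
    · simp [hj, Ne.symm hj]
  rw [real_inner_comm]
  exact h1.unique h2

theorem Orthonormal.hasSum_sq_of_hasSum_smul (hv : Orthonormal ℝ v) {c : ι → ℝ} {z : E}
    (h : HasSum (fun j => c j • v j) z) : HasSum (fun j => c j ^ 2) (‖z‖ ^ 2) := by
  have h1 : HasSum (fun j => ⟪z, c j • v j⟫) ⟪z, z⟫ := h.mapL (innerSL ℝ z)
  rw [real_inner_self_eq_norm_sq] at h1
  convert h1 using 2 with j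
  rw [inner_smul_right, hv.inner_eq_of_hasSum_smul h j, sq]

theorem Orthonormal.summable_inner_sq (hv : Orthonormal ℝ v) (x : E) :
    Summable fun j => ⟪x, v j⟫ ^ 2 := by
  simpa [real_inner_comm] using hv.inner_products_summable x

theorem Orthonormal.hasSum_inner_smul_of_mem_closure_span [CompleteSpace E]
    (hv : Orthonormal ℝ v) {x : E}
    (hx : x ∈ closure (Submodule.span ℝ (Set.range v) : Set E)) :
    HasSum (fun j => ⟪x, v j⟫ • v j) x := by
  have hsum : Summable fun j => ⟪x, v j⟫ • v j := by
    refine (hv.orthogonalFamily.summable_iff_norm_sq_summable fun j => ⟪x, v j⟫).mpr ?_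
    simpa using hv.summable_inner_sq x
  obtain ⟨s, hs⟩ := hsum
  have hs_mem : s ∈ (Submodule.span ℝ (Set.range v)).topologicalClosure :=
    (Submodule.isClosed_topologicalClosure _).mem_of_tendsto hs
      (Filter.Eventually.of_forall fun t => Submodule.sum_mem _ fun j _ =>
        Submodule.smul_mem _ _ (Submodule.le_topologicalClosure _
          (Submodule.subset_span (Set.mem_range_self j))))
  have hd_mem : x - s ∈ (Submodule.span ℝ (Set.range v)).topologicalClosure :=
    Submodule.sub_mem _ hx hs_mem
  have hd_orth : x - s ∈ (Submodule.span ℝ (Set.range v)).topologicalClosureᗮ := by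
    rw [Submodule.orthogonal_closure, Submodule.mem_orthogonal']
    intro w hw
    induction hw using Submodule.span_induction with
    | mem w hw =>
      obtain ⟨j, rfl⟩ := hw
      rw [inner_sub_left, hv.inner_eq_of_hasSum_smul hs j, sub_self]
    | zero => exact inner_zero_right _
    | add a b _ _ ha hb => rw [inner_add_right, ha, hb, add_zero]
    | smul r a _ ha => rw [inner_smul_right, ha, mul_zero]
  have hd : x - s = 0 :=
    inner_self_eq_zero.mp (Submodule.inner_right_of_mem_orthogonal hd_mem hd_orth)
  have hxs : s = x := (sub_eq_zero.mp hd).symm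
  rwa [hxs] at hs

/-- Bessel-type bound for a diagonal operator between orthonormal families. -/
theorem Orthonormal.norm_le_of_hasSum_mul_inner_smul {F : Type*} [NormedAddCommGroup F]
    [InnerProductSpace ℝ F] {u : ι → F} (hv : Orthonormal ℝ v) (hu : Orthonormal ℝ u)
    {m : ι → ℝ} {M : ℝ} (hM : 0 ≤ M) (hm : ∀ j, m j ^ 2 ≤ M) {w : F} {z : E}
    (h : HasSum (fun j => (m j * ⟪w, u j⟫) • v j) z) : ‖z‖ ≤ √M * ‖w‖ := by
  have hle : ‖z‖ ^ 2 ≤ M * ‖w‖ ^ 2 := by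
    calc ‖z‖ ^ 2 ≤ M * ∑' j, ⟪w, u j⟫ ^ 2 := by
          refine hasSum_le (fun j => ?_) (hv.hasSum_sq_of_hasSum_smul h)
            ((hu.summable_inner_sq w).hasSum.mul_left M)
          rw [mul_pow]
          exact mul_le_mul_of_nonneg_right (hm j) (sq_nonneg _)
      _ ≤ M * ‖w‖ ^ 2 := by
          refine mul_le_mul_of_nonneg_left ?_ hM
          simpa [real_inner_comm] using hu.tsum_inner_products_le w
  refine (sq_le_sq₀ (norm_nonneg _) (by positivity)).mp ?_
  rwa [mul_pow, Real.sq_sqrt hM]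

/-- Dominated convergence for orthonormal series with bounded multipliers. -/
theorem Orthonormal.tendsto_norm_of_hasSum_mul_smul (hv : Orthonormal ℝ v) {β : Type*}
    {l : Filter β} {c : ι → ℝ} (hc : Summable fun j => c j ^ 2) {m : β → ι → ℝ} {z : β → E}
    {K : ℝ} (hK : ∀ᶠ b in l, ∀ j, |m b j| ≤ K)
    (hm : ∀ j, Filter.Tendsto (fun b => m b j) l (𝓝 0))
    (hz : ∀ᶠ b in l, HasSum (fun j => (m b j * c j) • v j) (z b)) :
    Filter.Tendsto (fun b => ‖z b‖) l (𝓝 0) := by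
  have hsq : Filter.Tendsto (fun b => ∑' j, (m b j * c j) ^ 2) l (𝓝 (∑' _ : ι, (0 : ℝ))) := by
    refine tendsto_tsum_of_dominated_convergence (hc.mul_left (K ^ 2)) (fun j => ?_) ?_
    · simpa using ((hm j).mul_const (c j)).pow 2
    · filter_upwards [hK] with b hb j
      rw [Real.norm_of_nonneg (sq_nonneg _), mul_pow]
      exact mul_le_mul_of_nonneg_right (sq_le_sq.mpr ((hb j).trans (le_abs_self K)))
        (sq_nonneg _)
  have hsqrt := hsq.sqrt
  rw [tsum_zero, Real.sqrt_zero] at hsqrt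
  refine hsqrt.congr' ?_
  filter_upwards [hz] with b hb
  rw [(hv.hasSum_sq_of_hasSum_smul hb).tsum_eq, Real.sqrt_sq (norm_nonneg _)]

end OrthonormalSeries

/-- Filter-based spectral regularization with bias: under conditions (i)–(iii) on the
filter `r̂_L` and bias `b̂_L`, and the stated parameter choice, `T_{L(δ)}(y^δ) → x†`. -/
theorem filter_regularization_with_bias
    {X Y : Type*} [NormedAddCommGroup X] [InnerProductSpace ℝ X] [CompleteSpace X]
    [NormedAddCommGroup Y] [InnerProductSpace ℝ Y] [CompleteSpace Y]
    (A : X →L[ℝ] Y) (hAnorm : ‖A‖ ≤ 1)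
    (v : ℕ → X) (u : ℕ → Y) (σ : ℕ → ℝ)
    (hv : Orthonormal ℝ v) (hu : Orthonormal ℝ u)
    (hσ : ∀ j, σ j ∈ Set.Ioc (0 : ℝ) 1)
    (hsvd : ∀ x : X, HasSum (fun j => (σ j * ⟪x, v j⟫) • u j) (A x))
    (rhat : ℝ → ℝ → ℝ) (bhat : ℝ → X)
    (hbdd : ∀ L ∈ Set.Ico (0 : ℝ) 1, BddAbove (Set.range fun j => |rhat L (σ j ^ 2)|))
    (T : ℝ → Y → X)
    (hT : ∀ L ∈ Set.Ico (0 : ℝ) 1, ∀ y : Y,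
      HasSum (fun j => (rhat L (σ j ^ 2) * (σ j * ⟪y, u j⟫)) • v j) (T L y - bhat L))
    (hi : ∀ j, Filter.Tendsto (fun L => rhat L (σ j ^ 2)) (𝓝[<] (1 : ℝ)) (𝓝 (1 / σ j ^ 2)))
    (hii : ∃ C > (0 : ℝ), ∀ j, ∀ L ∈ Set.Ico (0 : ℝ) 1, σ j ^ 2 * |rhat L (σ j ^ 2)| ≤ C)
    (hiii : Filter.Tendsto (fun L => ‖bhat L‖) (𝓝[<] (1 : ℝ)) (𝓝 0))
    (xdag : X) (hx : xdag ∈ closure (Submodule.span ℝ (Set.range v) : Set X))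
    (Lc : ℝ → ℝ) (hLc : ∀ δ > (0 : ℝ), Lc δ ∈ Set.Ico (0 : ℝ) 1)
    (hLc1 : Filter.Tendsto Lc (𝓝[>] (0 : ℝ)) (𝓝 1))
    (hLc2 : Filter.Tendsto (fun δ => δ * Real.sqrt (⨆ j, |rhat (Lc δ) (σ j ^ 2)|))
      (𝓝[>] (0 : ℝ)) (𝓝 0))
    (ydel : ℝ → Y) (hy : ∀ δ > (0 : ℝ), ‖ydel δ - A xdag‖ ≤ δ) :
    Filter.Tendsto (fun δ => ‖T (Lc δ) (ydel δ) - xdag‖) (𝓝[>] (0 : ℝ)) (𝓝 0) := by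
  obtain ⟨C, hC, hCb⟩ := hii
  have hpos : ∀ᶠ δ : ℝ in 𝓝[>] (0 : ℝ), 0 < δ := self_mem_nhdsWithin
  have hLt : Filter.Tendsto Lc (𝓝[>] (0 : ℝ)) (𝓝[<] (1 : ℝ)) :=
    tendsto_nhdsWithin_iff.mpr ⟨hLc1, hpos.mono fun δ hδ => (hLc δ hδ).2⟩
  have hAx : ∀ j, ⟪A xdag, u j⟫ = σ j * ⟪xdag, v j⟫ :=
    hu.inner_eq_of_hasSum_smul (hsvd xdag)
  have hnoise : Filter.Tendsto (fun δ => ‖T (Lc δ) (ydel δ) - T (Lc δ) (A xdag)‖)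
      (𝓝[>] (0 : ℝ)) (𝓝 0) := by
    have hlim := hLc2.const_mul √C
    rw [mul_zero] at hlim
    refine squeeze_zero' (Filter.Eventually.of_forall fun _ => norm_nonneg _) ?_ hlim
    filter_upwards [hpos] with δ hδ
    have hL := hLc δ hδ
    set S := ⨆ j, |rhat (Lc δ) (σ j ^ 2)|
    have hS : 0 ≤ S := Real.iSup_nonneg fun _ => abs_nonneg _
    have hsum : HasSum (fun j => (rhat (Lc δ) (σ j ^ 2) * σ j * ⟪ydel δ - A xdag, u j⟫) • v j)
        (T (Lc δ) (ydel δ) - T (Lc δ) (A xdag)) := by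
      convert (hT _ hL (ydel δ)).sub (hT _ hL (A xdag)) using 1
      · ext j
        rw [← sub_smul, inner_sub_left]
        congr 1
        ring
      · abel
    have hm : ∀ j, (rhat (Lc δ) (σ j ^ 2) * σ j) ^ 2 ≤ C * S := fun j =>
      calc (rhat (Lc δ) (σ j ^ 2) * σ j) ^ 2
          = (σ j ^ 2 * |rhat (Lc δ) (σ j ^ 2)|) * |rhat (Lc δ) (σ j ^ 2)| := by
            rw [mul_pow, ← sq_abs (rhat _ _)]
            ring
        _ ≤ C * S :=
            mul_le_mul (hCb j _ hL) (le_ciSup (hbdd _ hL) j) (abs_nonneg _) hC.le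
    calc ‖T (Lc δ) (ydel δ) - T (Lc δ) (A xdag)‖
        ≤ √(C * S) * ‖ydel δ - A xdag‖ :=
          hv.norm_le_of_hasSum_mul_inner_smul hu (by positivity) hm hsum
      _ ≤ √(C * S) * δ := mul_le_mul_of_nonneg_left (hy δ hδ) (Real.sqrt_nonneg _)
      _ = √C * (δ * √S) := by
          rw [Real.sqrt_mul hC.le]
          ring
  have happrox : Filter.Tendsto (fun δ => ‖T (Lc δ) (A xdag) - bhat (Lc δ) - xdag‖)
      (𝓝[>] (0 : ℝ)) (𝓝 0) := by
    refine hv.tendsto_norm_of_hasSum_mul_smul (hv.summable_inner_sq xdag) (K := C + 1)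
      (m := fun δ j => rhat (Lc δ) (σ j ^ 2) * σ j ^ 2 - 1) ?_ (fun j => ?_) ?_
    · filter_upwards [hpos] with δ hδ j
      refine (abs_sub _ _).trans (add_le_add ?_ abs_one.le)
      rw [abs_mul, abs_of_nonneg (sq_nonneg (σ j)), mul_comm]
      exact hCb j _ (hLc δ hδ)
    · have hσj : σ j ^ 2 ≠ 0 := pow_ne_zero 2 (hσ j).1.ne'
      have hlim := (((hi j).comp hLt).mul_const (σ j ^ 2)).sub_const 1
      rwa [one_div_mul_cancel hσj, sub_self] at hlim
    · filter_upwards [hpos] with δ hδ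
      convert (hT _ (hLc δ hδ) (A xdag)).sub (hv.hasSum_inner_smul_of_mem_closure_span hx)
        using 1
      ext j
      rw [← sub_smul, hAx]
      congr 1
      ring
  have hlim := (hnoise.add happrox).add (hiii.comp hLt)
  simp only [add_zero] at hlim
  refine squeeze_zero (fun _ => norm_nonneg _) (fun δ => ?_) hlim
  calc ‖T (Lc δ) (ydel δ) - xdag‖
      = ‖T (Lc δ) (ydel δ) - T (Lc δ) (A xdag)
          + (T (Lc δ) (A xdag) - bhat (Lc δ) - xdag) + bhat (Lc δ)‖ := by
        congr 1
        abel
    _ ≤ _ := norm_add₃_le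
end

section
/- Let X be a real Hilbert space, A : X → X a bounded linear operator, L ∈ [0,1), and define φ : X → X by φ(x) = x − L(x − Ax). Let v ∈ X and σ² ∈ ℝ satisfy A v = σ² v. Then for all z, x̄ ∈ X with φ(x̄) = z it holds ⟨x̄, v⟩ = ⟨z, v⟩ / (1 − L + L σ²); equivalently, writing α = (1−L)/L for L > 0, ⟨x̄, v⟩ = (1/L) · (1/(α + σ²)) · ⟨z, v⟩, which is the standard Tikhonov filter with regularization parameter α. -/
open scoped RealInnerProductSpace

/-- The inverse of the one-parameter iResNet `φ(x) = x − L(x − Ax)` acts on the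
eigenvector components of the (self-adjoint, nonnegative spectrum) operator `A` as the
standard Tikhonov filter with regularization parameter `α = (1−L)/L`. -/
theorem one_parameter_tikhonov_filter
    {X : Type*} [NormedAddCommGroup X] [InnerProductSpace ℝ X]
    (A : X →L[ℝ] X) (hsa : ∀ x y : X, ⟪A x, y⟫ = ⟪x, A y⟫)
    (L : ℝ) (hL0 : 0 ≤ L) (hL1 : L < 1)
    (v : X) (σsq : ℝ) (hσsq : 0 ≤ σsq) (hv : A v = σsq • v)
    (z xbar : X) (h : xbar - L • (xbar - A xbar) = z) :
    ⟪xbar, v⟫ = ⟪z, v⟫ / (1 - L + L * σsq) ∧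
    (0 < L → ⟪xbar, v⟫ = (1 / L) * (1 / ((1 - L) / L + σsq)) * ⟪z, v⟫) := by
  have hpos : 0 < 1 - L + L * σsq := by
    have := mul_nonneg hL0 hσsq
    linarith
  have hz : ⟪z, v⟫ = (1 - L + L * σsq) * ⟪xbar, v⟫ := by
    rw [← h, inner_sub_left, real_inner_smul_left, inner_sub_left, hsa, hv,
      real_inner_smul_right]
    ring
  refine ⟨by rw [hz, mul_div_cancel_left₀ _ hpos.ne'], fun hL => ?_⟩
  have hfilter : (1 - L) / L + σsq = (1 - L + L * σsq) / L := by
    field_simp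
  rw [hz, hfilter]
  field_simp
end

section
/- Assume the SVD setting. For L ∈ [0,1) define φ_L : X → X by φ_L(x) = x − L(x − Ax), where A = Ã*Ã. Let x† ∈ X lie in the closed linear span of {v_j : j ∈ ℕ}. Then ‖φ_L⁻¹(A x†) − x†‖ → 0 as L → 1⁻; equivalently, Σ_{j∈ℕ} ( σ_j²/(1 − L(1 − σ_j²)) − 1 )² ⟨x†, v_j⟩² → 0 as L → 1⁻. -/
open scoped Topology RealInnerProductSpace

section OneParameterResolvent

variable {X Y : Type*} [NormedAddCommGroup X] [InnerProductSpace ℝ X] [CompleteSpace X]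
  [NormedAddCommGroup Y] [InnerProductSpace ℝ Y] [CompleteSpace Y]

/-- Energy estimate for the error `x - x₀` of the regularized solution `x`, in terms of an
approximate source representation `x₀ ≈ A†(A w)`. -/
theorem norm_sq_sub_le_of_sub_smul_sub_adjoint_eq (A : X →L[ℝ] Y) {L : ℝ} (hL0 : 0 < L)
    (hL1 : L < 1) {x x₀ : X}
    (h : x - L • (x - ContinuousLinearMap.adjoint A (A x)) = ContinuousLinearMap.adjoint A (A x₀))
    (w : X) :
    ‖x - x₀‖ ^ 2 ≤
      ‖(ContinuousLinearMap.id ℝ X - ContinuousLinearMap.adjoint A ∘L A)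
          (x₀ - ContinuousLinearMap.adjoint A (A w))‖ ^ 2 +
        (1 - L) / (2 * L) * ‖A (w - ContinuousLinearMap.adjoint A (A w))‖ ^ 2 := by
  set B := ContinuousLinearMap.adjoint A ∘L A with hB
  have hBA : ∀ y, ContinuousLinearMap.adjoint A (A y) = B y := fun _ => rfl
  simp only [hBA] at h ⊢
  set e := x - x₀ with he
  set r := (ContinuousLinearMap.id ℝ X - B) (x₀ - B w) with hr
  set q := w - B w with hq
  have hx : x = e + x₀ := by simp [he]
  have key : (1 - L) • e + L • B e = -(1 - L) • (r + B q) := by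
    have h' : x - L • (x - B x) - B x₀ = 0 := sub_eq_zero.2 h
    rw [hx] at h'
    rw [← sub_eq_zero, ← h', hr, hq]
    simp only [map_add, map_sub, sub_apply, ContinuousLinearMap.id_apply]
    module
  have hinner : ∀ y, ⟪B y, e⟫ = ⟪A y, A e⟫ := fun y => by
    rw [← hBA, ContinuousLinearMap.adjoint_inner_left]
  have henergy : (1 - L) * ‖e‖ ^ 2 + L * ‖A e‖ ^ 2 = -(1 - L) * (⟪r, e⟫ + ⟪A q, A e⟫) := by
    have := congrArg (fun y => ⟪y, e⟫) key
    simpa only [inner_add_left, real_inner_smul_left, hinner, real_inner_self_eq_norm_sq]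
      using this
  have hr' : -⟪r, e⟫ ≤ ‖r‖ * ‖e‖ :=
    (neg_le_abs _).trans (abs_real_inner_le_norm r e)
  have hq' : -⟪A q, A e⟫ ≤ ‖A q‖ * ‖A e‖ :=
    (neg_le_abs _).trans (abs_real_inner_le_norm _ _)
  have hpos : 0 < 1 - L := by linarith
  have hyoung : (1 - L) * (‖A q‖ * ‖A e‖) ≤
      L * ‖A e‖ ^ 2 + (1 - L) * ((1 - L) / (4 * L) * ‖A q‖ ^ 2) := by
    have hsq : L * ‖A e‖ ^ 2 + (1 - L) * ((1 - L) / (4 * L) * ‖A q‖ ^ 2) -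
        (1 - L) * (‖A q‖ * ‖A e‖) = (2 * L * ‖A e‖ - (1 - L) * ‖A q‖) ^ 2 / (4 * L) := by
      field_simp
      ring
    have : 0 ≤ (2 * L * ‖A e‖ - (1 - L) * ‖A q‖) ^ 2 / (4 * L) := by positivity
    linarith
  have hmain : ‖e‖ ^ 2 ≤ ‖r‖ * ‖e‖ + (1 - L) / (4 * L) * ‖A q‖ ^ 2 := by
    refine le_of_mul_le_mul_left ?_ hpos
    have h1 := mul_le_mul_of_nonneg_left hr' hpos.le
    have h2 := mul_le_mul_of_nonneg_left hq' hpos.le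
    linarith
  have hhalf : (1 - L) / (2 * L) * ‖A q‖ ^ 2 = 2 * ((1 - L) / (4 * L) * ‖A q‖ ^ 2) := by
    field_simp
    ring
  rw [hhalf]
  nlinarith [sq_nonneg (‖r‖ - ‖e‖)]

/-- The regularized solutions converge to every `x₀` in the closure of the range of `A†A`. -/
theorem tendsto_norm_sub_of_mem_closure_range_adjoint_comp (A : X →L[ℝ] Y) {x₀ : X}
    (hx₀ : x₀ ∈ closure (Set.range (ContinuousLinearMap.adjoint A ∘L A))) {x : ℝ → X}
    (hx : ∀ L ∈ Set.Ico (0 : ℝ) 1,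
      x L - L • (x L - ContinuousLinearMap.adjoint A (A (x L))) =
        ContinuousLinearMap.adjoint A (A x₀)) :
    Filter.Tendsto (fun L => ‖x L - x₀‖) (𝓝[<] (1 : ℝ)) (𝓝 0) := by
  set T := ContinuousLinearMap.id ℝ X - ContinuousLinearMap.adjoint A ∘L A with hT
  rw [Metric.tendsto_nhds]
  intro ε hε
  obtain ⟨w, hw⟩ : ∃ w, ‖T (x₀ - ContinuousLinearMap.adjoint A (A w))‖ < ε / 2 := by
    have hopen : IsOpen {y | ‖T (x₀ - y)‖ < ε / 2} :=
      isOpen_lt (by fun_prop) continuous_const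
    obtain ⟨_, hy, w, rfl⟩ := mem_closure_iff.1 hx₀ _ hopen (by simp [hε])
    exact ⟨w, hy⟩
  have hlim : Filter.Tendsto (fun L : ℝ => (1 - L) / (2 * L) *
      ‖A (w - ContinuousLinearMap.adjoint A (A w))‖ ^ 2) (𝓝[<] 1) (𝓝 0) := by
    have hc : ContinuousAt (fun L : ℝ => (1 - L) / (2 * L) *
        ‖A (w - ContinuousLinearMap.adjoint A (A w))‖ ^ 2) 1 := by
      refine ContinuousAt.mul (ContinuousAt.div (by fun_prop) (by fun_prop) (by norm_num))
        continuousAt_const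
    simpa using hc.tendsto.mono_left nhdsWithin_le_nhds
  filter_upwards [hlim.eventually_lt_const (show (0 : ℝ) < ε ^ 2 / 2 by positivity),
    Ioo_mem_nhdsLT (zero_lt_one' ℝ)] with L hLε hL
  have hest := norm_sq_sub_le_of_sub_smul_sub_adjoint_eq A hL.1 hL.2 (hx L ⟨hL.1.le, hL.2⟩) w
  have hw2 : ‖T (x₀ - ContinuousLinearMap.adjoint A (A w))‖ ^ 2 < (ε / 2) ^ 2 :=
    pow_lt_pow_left₀ hw (norm_nonneg _) two_ne_zero
  rw [dist_zero_right, norm_norm]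
  refine lt_of_pow_lt_pow_left₀ 2 hε.le ?_
  nlinarith

end OneParameterResolvent

/-- For a singular value decomposition, `A†A` scales each right singular vector by the squared
singular value. -/
theorem adjoint_apply_singular_vector {X Y : Type*}
    [NormedAddCommGroup X] [InnerProductSpace ℝ X] [CompleteSpace X]
    [NormedAddCommGroup Y] [InnerProductSpace ℝ Y] [CompleteSpace Y]
    {ι : Type*} (A : X →L[ℝ] Y) {v : ι → X} {u : ι → Y} {σ : ι → ℝ}
    (hv : Orthonormal ℝ v) (hu : Orthonormal ℝ u)
    (hsvd : ∀ x : X, HasSum (fun j => (σ j * ⟪x, v j⟫) • u j) (A x)) (j : ι) :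
    ContinuousLinearMap.adjoint A (A (v j)) = (σ j ^ 2) • v j := by
  classical
  have hinner : ∀ x, ⟪u j, A x⟫ = σ j * ⟪x, v j⟫ := fun x => by
    have h := (hsvd x).mapL (innerSL ℝ (u j))
    simp only [innerSL_apply_apply, real_inner_smul_right, orthonormal_iff_ite.1 hu] at h
    simpa using h.unique (hasSum_single j fun i hi => by simp [hi.symm])
  have hA : A (v j) = σ j • u j := by
    have h := hsvd (v j)
    simp only [orthonormal_iff_ite.1 hv] at h
    simpa using h.unique (hasSum_single j fun i hi => by simp [hi.symm])
  refine ext_inner_right ℝ fun x => ?_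
  rw [ContinuousLinearMap.adjoint_inner_left, hA, real_inner_smul_left, hinner,
    real_inner_smul_left, real_inner_comm]
  ring

/-- Noise-free convergence of the one-parameter iResNet reconstruction: for
`φ_L(x) = x − L(x − Ax)` with `A = Ã*Ã`, the solutions of `φ_L(x_L) = A x†` converge
to `x†` as `L → 1⁻`, for any `x†` in the closed span of the singular functions. -/
theorem one_parameter_noise_free_convergence
    {X Y : Type*} [NormedAddCommGroup X] [InnerProductSpace ℝ X] [CompleteSpace X]
    [NormedAddCommGroup Y] [InnerProductSpace ℝ Y] [CompleteSpace Y]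
    (A : X →L[ℝ] Y) (hAnorm : ‖A‖ ≤ 1)
    (v : ℕ → X) (u : ℕ → Y) (σ : ℕ → ℝ)
    (hv : Orthonormal ℝ v) (hu : Orthonormal ℝ u)
    (hσ : ∀ j, σ j ∈ Set.Ioc (0 : ℝ) 1)
    (hsvd : ∀ x : X, HasSum (fun j => (σ j * ⟪x, v j⟫) • u j) (A x))
    (xdag : X) (hx : xdag ∈ closure (Submodule.span ℝ (Set.range v) : Set X))
    (xL : ℝ → X)
    (hxL : ∀ L ∈ Set.Ico (0 : ℝ) 1,
      xL L - L • (xL L - ContinuousLinearMap.adjoint A (A (xL L))) =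
        ContinuousLinearMap.adjoint A (A xdag)) :
    Filter.Tendsto (fun L => ‖xL L - xdag‖) (𝓝[<] (1 : ℝ)) (𝓝 0) := by
  refine tendsto_norm_sub_of_mem_closure_range_adjoint_comp A (closure_mono ?_ hx) hxL
  rw [← ContinuousLinearMap.coe_coe, ← LinearMap.coe_range, SetLike.coe_subset_coe,
    Submodule.span_le]
  rintro _ ⟨j, rfl⟩
  have hj : σ j ^ 2 ≠ 0 := pow_ne_zero 2 (hσ j).1.ne'
  refine ⟨(σ j ^ 2)⁻¹ • v j, ?_⟩
  simp [adjoint_apply_singular_vector A hv hu hsvd, smul_smul, hj]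
end

section
/- Let σ² ∈ (0,1], L ∈ [0,1), and let a₁, …, a_N ∈ ℝ with mean μ = (1/N) Σᵢ aᵢ and aᵢ ≠ μ for at least one i. Then the function (w, b) ↦ Σ_{i=1}^N ((1 − w − σ²) aᵢ − b)² attains its minimum over [−L, L] × ℝ uniquely at w = min{1 − σ², L} and b = max{0, 1 − L − σ²} · μ. -/
/-- Bias-variance decomposition of the affine least-squares loss. -/
theorem sum_mul_sub_sq_eq {N : ℕ} (a : Fin N → ℝ) (μ : ℝ) (hμ : ∑ i, a i = N * μ) (c b : ℝ) :
    ∑ i, (c * a i - b) ^ 2 = c ^ 2 * ∑ i, (a i - μ) ^ 2 + N * (c * μ - b) ^ 2 := by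
  have h : ∀ i, (c * a i - b) ^ 2 =
      c ^ 2 * (a i - μ) ^ 2 + (2 * c * (c * μ - b)) * a i +
        ((c * μ - b) ^ 2 - 2 * c * (c * μ - b) * μ) := fun i => by ring
  simp only [h, Finset.sum_add_distrib, ← Finset.mul_sum, hμ, Finset.sum_const,
    Finset.card_univ, Fintype.card_fin, nsmul_eq_mul]
  ring


/-- The componentwise approximation-training problem for the affine linear iResNet
residual attains its minimum over `(w, b) ∈ [−L, L] × ℝ` uniquely at
`w = min{1 − σ², L}` and `b = max{0, 1 − L − σ²} μ`. -/
theorem affine_componentwise_training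
    (σsq L : ℝ) (hσsq : σsq ∈ Set.Ioc (0 : ℝ) 1) (hL : L ∈ Set.Ico (0 : ℝ) 1)
    (N : ℕ) (a : Fin N → ℝ) (μ : ℝ) (hμ : μ = (∑ i, a i) / N)
    (ha : ∃ i, a i ≠ μ) :
    (∀ w ∈ Set.Icc (-L) L, ∀ b : ℝ,
      ∑ i, ((1 - min (1 - σsq) L - σsq) * a i - max 0 (1 - L - σsq) * μ) ^ 2 ≤
        ∑ i, ((1 - w - σsq) * a i - b) ^ 2) ∧
    (∀ w ∈ Set.Icc (-L) L, ∀ b : ℝ,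
      ∑ i, ((1 - w - σsq) * a i - b) ^ 2 =
        ∑ i, ((1 - min (1 - σsq) L - σsq) * a i - max 0 (1 - L - σsq) * μ) ^ 2 →
        w = min (1 - σsq) L ∧ b = max 0 (1 - L - σsq) * μ) := by
  obtain ⟨j, hj⟩ := ha
  have hN : (0 : ℝ) < N := by exact_mod_cast j.pos
  have hsum : ∑ i, a i = N * μ := by rw [hμ]; field_simp
  have hV : 0 < ∑ i, (a i - μ) ^ 2 :=
    Finset.sum_pos' (fun i _ => sq_nonneg _)
      ⟨j, Finset.mem_univ j, by have := sub_ne_zero.mpr hj; positivity⟩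
  have hm : 1 - min (1 - σsq) L - σsq = max 0 (1 - L - σsq) := by
    rcases le_total (1 - σsq) L with h | h
    · rw [min_eq_left h, max_eq_left (by linarith)]; ring
    · rw [min_eq_right h, max_eq_right (by linarith)]
  have hsq : ∀ w ∈ Set.Icc (-L) L, max 0 (1 - L - σsq) ^ 2 ≤ (1 - w - σsq) ^ 2 ∧
      ((1 - w - σsq) ^ 2 = max 0 (1 - L - σsq) ^ 2 → 1 - w - σsq = max 0 (1 - L - σsq)) := by
    intro w hw
    rcases le_total (1 - L - σsq) 0 with h | h
    · rw [max_eq_left h]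
      exact ⟨by nlinarith [sq_nonneg (1 - w - σsq)], fun h0 => by simpa using h0⟩
    · rw [max_eq_right h]
      have hle : 1 - L - σsq ≤ 1 - w - σsq := by linarith [hw.2]
      exact ⟨pow_le_pow_left₀ h hle 2, fun h0 => (sq_eq_sq₀ (h.trans hle) h).mp h0⟩
  rw [hm]
  simp only [sum_mul_sub_sq_eq a μ hsum, sub_self]
  set V := ∑ i, (a i - μ) ^ 2
  refine ⟨fun w hw b => ?_, fun w hw b heq => ?_⟩
  · have h1 := mul_le_mul_of_nonneg_right (hsq w hw).1 hV.le
    have h2 := mul_nonneg hN.le (sq_nonneg ((1 - w - σsq) * μ - b))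
    linarith
  · have h1 := mul_le_mul_of_nonneg_right (hsq w hw).1 hV.le
    have h2 := mul_nonneg hN.le (sq_nonneg ((1 - w - σsq) * μ - b))
    have hd := (hsq w hw).2 (mul_right_cancel₀ hV.ne' (by linarith))
    have hb : (N : ℝ) * ((1 - w - σsq) * μ - b) ^ 2 = 0 := by linarith
    have hb' : (1 - w - σsq) * μ - b = 0 :=
      pow_eq_zero_iff two_ne_zero |>.mp ((mul_eq_zero.mp hb).resolve_left hN.ne')
    exact ⟨by linarith, by rw [← hd]; linarith⟩
end

section
/- Assume the SVD setting and let L ∈ [0,1). Let (μ_j)_{j∈ℕ} ∈ ℓ², define w_j = min{1 − σ_j², L} and b = Σ_{j∈ℕ} max{0, 1 − L − σ_j²} μ_j v_j, and let W : X → X be the bounded linear operator W x = Σ_{j∈ℕ} w_j ⟨x, v_j⟩ v_j. Define φ : X → X by φ(x) = x − Wx − b. Then for all z, x̄ ∈ X with φ(x̄) = z and every j ∈ ℕ it holds ⟨x̄, v_j⟩ = ⟨z, v_j⟩ / max{σ_j², 1−L} + max{0, 1 − L − σ_j²} μ_j / max{σ_j², 1−L}. In particular, the reconstruction is the linear spectral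 filter with bias given by r̂_L(σ²) = 1/max{σ², 1−L} (the squared soft TSVD filter) and bias coefficients max{0, 1−L−σ_j²} μ_j / (1−L). -/
open scoped RealInnerProductSpace

/-- The coefficients of a convergent expansion in an orthonormal family are inner products. -/
theorem Orthonormal.inner_eq_of_hasSum {X ι : Type*} [NormedAddCommGroup X]
    [InnerProductSpace ℝ X] {v : ι → X} (hv : Orthonormal ℝ v) {c : ι → ℝ} {x : X}
    (hx : HasSum (fun i => c i • v i) x) (j : ι) : ⟪x, v j⟫ = c j := by
  classical
  rw [real_inner_comm]
  have h := hx.mapL (innerSL ℝ (v j))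
  simp only [innerSL_apply_apply, inner_smul_right, orthonormal_iff_ite.mp hv, mul_ite, mul_one,
    mul_zero] at h
  simpa using h.unique (hasSum_single j fun i hij => if_neg hij.symm)

/-- The inverse of the trained affine linear iResNet `φ(x) = x − Wx − b` acts as the
squared soft TSVD spectral filter `r̂_L(σ²) = 1/max{σ², 1−L}` with bias coefficients
`max{0, 1−L−σ_j²} μ_j / (1−L)` (here written as `max{0,1−L−σ_j²} μ_j / max{σ_j²,1−L}`
on the singular components). -/
theorem affine_network_squared_soft_TSVD
    {X Y : Type*} [NormedAddCommGroup X] [InnerProductSpace ℝ X] [CompleteSpace X]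
    [NormedAddCommGroup Y] [InnerProductSpace ℝ Y] [CompleteSpace Y]
    (A : X →L[ℝ] Y) (hAnorm : ‖A‖ ≤ 1)
    (v : ℕ → X) (u : ℕ → Y) (σ : ℕ → ℝ)
    (hv : Orthonormal ℝ v) (hu : Orthonormal ℝ u)
    (hσ : ∀ j, σ j ∈ Set.Ioc (0 : ℝ) 1)
    (hsvd : ∀ x : X, HasSum (fun j => (σ j * ⟪x, v j⟫) • u j) (A x))
    (L : ℝ) (hL : L ∈ Set.Ico (0 : ℝ) 1)
    (μ : ℕ → ℝ) (hμ : Summable fun j => μ j ^ 2)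
    (W : X →L[ℝ] X)
    (hW : ∀ x : X, HasSum (fun j => (min (1 - σ j ^ 2) L * ⟪x, v j⟫) • v j) (W x))
    (b : X) (hb : HasSum (fun j => (max 0 (1 - L - σ j ^ 2) * μ j) • v j) b)
    (z xbar : X) (h : xbar - W xbar - b = z) (j : ℕ) :
    ⟪xbar, v j⟫ = ⟪z, v j⟫ / max (σ j ^ 2) (1 - L) +
      max 0 (1 - L - σ j ^ 2) * μ j / max (σ j ^ 2) (1 - L) := by
  have hW_j : ⟪W xbar, v j⟫ = min (1 - σ j ^ 2) L * ⟪xbar, v j⟫ :=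
    hv.inner_eq_of_hasSum (hW xbar) j
  have hb_j : ⟪b, v j⟫ = max 0 (1 - L - σ j ^ 2) * μ j := hv.inner_eq_of_hasSum hb j
  have h_filter : max (σ j ^ 2) (1 - L) = 1 - min (1 - σ j ^ 2) L := by
    rw [← max_sub_sub_left, sub_sub_cancel]
  have h_pos : 0 < max (σ j ^ 2) (1 - L) := lt_max_of_lt_right (sub_pos.mpr hL.2)
  rw [← add_div, eq_div_iff h_pos.ne', ← h, inner_sub_left, inner_sub_left, hW_j, hb_j, h_filter]
  ring
end

section
/- Assume the SVD setting and suppose additionally that for every t > 0 only finitely many j satisfy σ_j² ≤ t or that σ_j → 0. For L ∈ [0,1) let (μ_j)_{j∈ℕ} ∈ ℓ², w_j = min{1 − σ_j², L}, b_L = Σ_j max{0, 1 − L − σ_j²} μ_j v_j, W_L x = Σ_j w_j ⟨x, v_j⟩ v_j, and φ_L(x) = x − W_L x − b_L. Let x† ∈ X lie in the closed linear span of {v_j : j ∈ ℕ} and assume there are an index function ψ, a constant C > 0 and β̄ ∈ (0,1] such that Σ_{j : σ_j² ≤ β} ⟨x†, v_j⟩² ≤ C ψ(β)² for all β ∈ (0,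 β̄). Then there exist an index function ψ̃, a constant C' > 0 and L₀ ∈ [0,1) such that ‖A x† − φ_L(x†)‖ ≤ C' (1−L) ψ̃(1−L) for all L ∈ [L₀, 1), i.e., x† fulfills the local approximation property. -/
open scoped RealInnerProductSpace

section OrthonormalExpansion

variable {X : Type*} [NormedAddCommGroup X] [InnerProductSpace ℝ X]

theorem Orthonormal.inner_left_eq_of_hasSum {ι : Type*} {v : ι → X} (hv : Orthonormal ℝ v)
    {c : ι → ℝ} {r : X} (h : HasSum (fun j => c j • v j) r) (i : ι) : ⟪v i, r⟫ = c i := by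
  classical
  have h1 : HasSum (fun j => ⟪v i, c j • v j⟫) ⟪v i, r⟫ := h.mapL (innerSL ℝ (v i))
  have h2 : HasSum (fun j => ⟪v i, c j • v j⟫) (⟪v i, c i • v i⟫) := by
    refine hasSum_single i fun j hj => ?_
    rw [inner_smul_right, hv.2 hj.symm, mul_zero]
  rw [h1.unique h2, inner_smul_right, real_inner_self_eq_norm_sq, hv.1 i]
  ring

theorem Orthonormal.hasSum_sq_of_hasSum {ι : Type*} {v : ι → X} (hv : Orthonormal ℝ v)
    {c : ι → ℝ} {r : X} (h : HasSum (fun j => c j • v j) r) :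
    HasSum (fun j => c j ^ 2) (‖r‖ ^ 2) := by
  have h1 : HasSum (fun j => ⟪r, c j • v j⟫) ⟪r, r⟫ := h.mapL (innerSL ℝ r)
  rw [real_inner_self_eq_norm_sq] at h1
  refine h1.congr_fun fun j => ?_
  rw [inner_smul_right, real_inner_comm, hv.inner_left_eq_of_hasSum h, sq]

theorem Orthonormal.hasSum_of_mem_closure_span [CompleteSpace X] {ι : Type*} {v : ι → X}
    (hv : Orthonormal ℝ v) {x : X}
    (hx : x ∈ closure (Submodule.span ℝ (Set.range v) : Set X)) :
    HasSum (fun j => ⟪x, v j⟫ • v j) x := by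
  have hsum : Summable fun j => ⟪x, v j⟫ • v j := by
    have h := (hv.orthogonalFamily.summable_iff_norm_sq_summable (fun j => ⟪x, v j⟫)).2
      (by simpa [real_inner_comm] using hv.inner_products_summable x)
    simpa using h
  obtain ⟨y, hy⟩ := hsum
  set K := (Submodule.span ℝ (Set.range v)).topologicalClosure with hK
  have hyK : y ∈ K := by
    refine (Submodule.isClosed_topologicalClosure _).mem_of_tendsto hy
      (Filter.Eventually.of_forall fun s => ?_)
    exact K.sum_mem fun j _ => K.smul_mem _
      (Submodule.le_topologicalClosure _ (Submodule.subset_span ⟨j, rfl⟩))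
  have hxyK : x - y ∈ K := K.sub_mem hx hyK
  have hperp : x - y ∈ Kᗮ := by
    rw [hK, Submodule.orthogonal_closure, Submodule.mem_orthogonal]
    intro w hw
    induction hw using Submodule.span_induction with
    | mem w hw =>
      obtain ⟨j, rfl⟩ := hw
      rw [inner_sub_right, hv.inner_left_eq_of_hasSum hy, real_inner_comm, sub_self]
    | zero => simp
    | add a b _ _ ha hb => rw [inner_add_left, ha, hb, add_zero]
    | smul t a _ ha => rw [inner_smul_left, ha, mul_zero]
  have h0 : x - y = 0 := by
    simpa using (Submodule.mem_orthogonal _ _).1 hperp _ hxyK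
  have hxy : y = x := (sub_eq_zero.1 h0).symm
  exact hxy ▸ hy

/-- A singular value expansion of `A` yields the spectral expansion of `A* A`. -/
theorem hasSum_adjoint_comp_self [CompleteSpace X] {Y : Type*} [NormedAddCommGroup Y]
    [InnerProductSpace ℝ Y] [CompleteSpace Y] {ι : Type*} {A : X →L[ℝ] Y} {v : ι → X} {u : ι → Y}
    {σ : ι → ℝ} (hu : Orthonormal ℝ u)
    (hsvd : ∀ x : X, HasSum (fun j => (σ j * ⟪x, v j⟫) • u j) (A x)) (x : X) :
    HasSum (fun j => (σ j ^ 2 * ⟪x, v j⟫) • v j) (ContinuousLinearMap.adjoint A (A x)) := by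
  have hadj : ∀ j, ContinuousLinearMap.adjoint A (u j) = σ j • v j := by
    intro j
    refine ext_inner_right ℝ fun z => ?_
    rw [ContinuousLinearMap.adjoint_inner_left, hu.inner_left_eq_of_hasSum (hsvd z),
      real_inner_smul_left, real_inner_comm]
  refine ((hsvd x).mapL (ContinuousLinearMap.adjoint A)).congr_fun fun j => ?_
  rw [map_smul, hadj, smul_smul]
  ring_nf

end OrthonormalExpansion

theorem abs_min_one_div_mul_le {s t a : ℝ} (hs : 0 < s) (ht : 0 ≤ t) (ha : 0 ≤ a) :
    |min 1 (t / s) * a| ≤ a := by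
  have h0 : 0 ≤ min 1 (t / s) := le_min zero_le_one (by positivity)
  rw [abs_of_nonneg (by positivity)]
  exact mul_le_of_le_one_left ha (min_le_left _ _)

/-- A summable nonnegative family with positive weights `s` has an index function dominating the
square root of the truncated sums over `s j ≤ t`. -/
theorem isIndexFunction_add_sqrt_tsum {ι : Type*} {s a : ι → ℝ} (hs : ∀ j, 0 < s j)
    (ha : ∀ j, 0 ≤ a j) (hsum : Summable a) :
    IsIndexFunction fun t => t + √(∑' j, min 1 (t / s j) * a j) := by
  have hsm : ∀ t : ℝ, 0 ≤ t → Summable fun j => min 1 (t / s j) * a j := fun t ht =>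
    hsum.of_norm_bounded fun j => abs_min_one_div_mul_le (hs j) ht (ha j)
  refine ⟨?_, ?_, by simp, fun t ht => add_nonneg ht (Real.sqrt_nonneg _)⟩
  · refine continuousOn_id.add (Real.continuous_sqrt.comp_continuousOn ?_)
    refine continuousOn_tsum (fun j => Continuous.continuousOn (by fun_prop)) hsum ?_
    exact fun j t ht => abs_min_one_div_mul_le (hs j) ht (ha j)
  · intro t ht t' ht' htt'
    refine add_lt_add_of_lt_of_le htt' (Real.sqrt_le_sqrt ?_)
    refine (hsm t ht).tsum_le_tsum (fun j => ?_) (hsm t' ht')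
    have := hs j
    exact mul_le_mul_of_nonneg_right (min_le_min le_rfl (by gcongr)) (ha j)

theorem max_sub_sq_le {s t : ℝ} (hs : 0 < s) (ht : 0 ≤ t) :
    max 0 (t - s) ^ 2 ≤ t ^ 2 * min 1 (t / s) := by
  rcases le_total t s with h | h
  · rw [max_eq_left (by linarith)]
    have : 0 ≤ min 1 (t / s) := le_min zero_le_one (by positivity)
    simpa using by positivity
  · rw [max_eq_right (by linarith), min_eq_left ((one_le_div hs).2 h), mul_one]
    exact pow_le_pow_left₀ (by linarith) (by linarith) 2

/-- Under the technical source condition, the trained affine linear (squared soft TSVD)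
iResNet family fulfills the local approximation property at `x†`. -/
theorem squared_soft_TSVD_local_approximation
    {X Y : Type*} [NormedAddCommGroup X] [InnerProductSpace ℝ X] [CompleteSpace X]
    [NormedAddCommGroup Y] [InnerProductSpace ℝ Y] [CompleteSpace Y]
    (A : X →L[ℝ] Y) (hAnorm : ‖A‖ ≤ 1)
    (v : ℕ → X) (u : ℕ → Y) (σ : ℕ → ℝ)
    (hv : Orthonormal ℝ v) (hu : Orthonormal ℝ u)
    (hσ : ∀ j, σ j ∈ Set.Ioc (0 : ℝ) 1)
    (hsvd : ∀ x : X, HasSum (fun j => (σ j * ⟪x, v j⟫) • u j) (A x))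
    (hfin : (∀ t > (0 : ℝ), {j : ℕ | σ j ^ 2 ≤ t}.Finite) ∨
      Filter.Tendsto σ Filter.atTop (nhds 0))
    (μ : ℕ → ℝ) (hμ : Summable fun j => μ j ^ 2)
    (W : ℝ → X →L[ℝ] X)
    (hW : ∀ L ∈ Set.Ico (0 : ℝ) 1, ∀ x : X,
      HasSum (fun j => (min (1 - σ j ^ 2) L * ⟪x, v j⟫) • v j) (W L x))
    (b : ℝ → X)
    (hb : ∀ L ∈ Set.Ico (0 : ℝ) 1,
      HasSum (fun j => (max 0 (1 - L - σ j ^ 2) * μ j) • v j) (b L))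
    (xdag : X) (hx : xdag ∈ closure (Submodule.span ℝ (Set.range v) : Set X))
    (ψ : ℝ → ℝ) (hψ : IsIndexFunction ψ)
    (C : ℝ) (hC : 0 < C) (βbar : ℝ) (hβbar : βbar ∈ Set.Ioc (0 : ℝ) 1)
    (hsource : ∀ β ∈ Set.Ioo (0 : ℝ) βbar,
      ∑' j : {j : ℕ // σ j ^ 2 ≤ β}, ⟪xdag, v j⟫ ^ 2 ≤ C * ψ β ^ 2) :
    ∃ ψt : ℝ → ℝ, IsIndexFunction ψt ∧ ∃ C' > (0 : ℝ), ∃ L₀ ∈ Set.Ico (0 : ℝ) 1,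
      ∀ L ∈ Set.Ico L₀ 1,
        ‖ContinuousLinearMap.adjoint A (A xdag) - (xdag - W L xdag - b L)‖ ≤
          C' * (1 - L) * ψt (1 - L) := by
  have hσ2 : ∀ j, 0 < σ j ^ 2 := fun j => pow_pos (hσ j).1 2
  have hxsum := hv.hasSum_of_mem_closure_span hx
  have hc : Summable fun j => (μ j - ⟪xdag, v j⟫) ^ 2 := by
    refine ((hμ.add (hv.hasSum_sq_of_hasSum hxsum).summable).mul_left 2).of_nonneg_of_le
      (fun j => sq_nonneg _) fun j => ?_
    nlinarith [sq_nonneg (μ j + ⟪xdag, v j⟫)]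
  refine ⟨_, isIndexFunction_add_sqrt_tsum hσ2 (fun j => sq_nonneg _) hc, 1, one_pos, 0,
    ⟨le_rfl, one_pos⟩, fun L hL => ?_⟩
  have ht : 0 ≤ 1 - L := by linarith [hL.2]
  have hres : HasSum (fun j => (max 0 (1 - L - σ j ^ 2) * (μ j - ⟪xdag, v j⟫)) • v j)
      (ContinuousLinearMap.adjoint A (A xdag) - (xdag - W L xdag - b L)) := by
    refine ((hasSum_adjoint_comp_self hu hsvd xdag).sub
      ((hxsum.sub (hW L hL xdag)).sub (hb L hL))).congr_fun fun j => ?_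
    simp only [← sub_smul]
    congr 1
    rcases le_total (1 - σ j ^ 2) L with h | h
    · rw [min_eq_left h, max_eq_left (by linarith)]
      ring
    · rw [min_eq_right h, max_eq_right (by linarith)]
      ring
  have hsq := hv.hasSum_sq_of_hasSum hres
  have hsm : Summable fun j => min 1 ((1 - L) / σ j ^ 2) * (μ j - ⟪xdag, v j⟫) ^ 2 :=
    hc.of_norm_bounded fun j => abs_min_one_div_mul_le (hσ2 j) ht (sq_nonneg _)
  have hle : ‖ContinuousLinearMap.adjoint A (A xdag) - (xdag - W L xdag - b L)‖ ^ 2 ≤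
      (1 - L) ^ 2 * ∑' j, min 1 ((1 - L) / σ j ^ 2) * (μ j - ⟪xdag, v j⟫) ^ 2 := by
    refine hasSum_le (fun j => ?_) hsq (hsm.hasSum.mul_left _)
    rw [mul_pow, ← mul_assoc]
    exact mul_le_mul_of_nonneg_right (max_sub_sq_le (hσ2 j) ht) (sq_nonneg _)
  have hnorm := Real.le_sqrt_of_sq_le hle
  rw [Real.sqrt_mul (sq_nonneg _), Real.sqrt_sq ht] at hnorm
  rw [one_mul]
  exact hnorm.trans (mul_le_mul_of_nonneg_left (le_add_of_nonneg_left ht) ht)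
end

section
/- Let σ² ∈ (0,1), L ∈ (0,1), and let a₁, …, a_N ∈ ℝ with aᵢ > 0 for at least one i. Then the function w ↦ Σ_{i=1}^N ((1 − σ²) aᵢ − max(0, w aᵢ))² attains its minimum over the interval [−L, L] uniquely at w = min{1 − σ², L}. -/
/-- A strictly better slope gives a strictly smaller ReLU residual at positive inputs. -/
theorem relu_residual_lt {c L w a : ℝ} (hc : 0 < c) (hL : 0 < L) (hw : w ≤ L) (ha : 0 < a)
    (hne : w ≠ min c L) :
    (c * a - max 0 (min c L * a)) ^ 2 < (c * a - max 0 (w * a)) ^ 2 := by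
  have hm : 0 < min c L := lt_min hc hL
  have hslope : (c - min c L) ^ 2 < (c - max 0 w) ^ 2 := by
    rcases le_total c L with h | h
    · rw [min_eq_left h] at hne ⊢
      have hmax : c - max 0 w ≠ 0 := by
        rcases le_total 0 w with h0 | h0
        · rw [max_eq_right h0]
          exact sub_ne_zero.mpr hne.symm
        · rw [max_eq_left h0]
          linarith
      simpa using pow_pos (abs_pos.mpr hmax) 2
    · rw [min_eq_right h] at hne ⊢
      have hmax : max 0 w < L := max_lt hL (lt_of_le_of_ne hw hne)
      exact pow_lt_pow_left₀ (by linarith) (by linarith) two_ne_zero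
  have hfactor (v : ℝ) : (c * a - max 0 (v * a)) ^ 2 = (c - max 0 v) ^ 2 * a ^ 2 := by
    have hmax : max 0 (v * a) = max 0 v * a := by
      rw [max_mul_of_nonneg _ _ ha.le, zero_mul]
    rw [hmax]
    ring
  rw [hfactor, hfactor, max_eq_right hm.le]
  exact mul_lt_mul_of_pos_right hslope (by positivity)

theorem relu_residual_le {c L w : ℝ} (hc : 0 < c) (hL : 0 < L) (hw : w ≤ L) (a : ℝ) :
    (c * a - max 0 (min c L * a)) ^ 2 ≤ (c * a - max 0 (w * a)) ^ 2 := by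
  rcases eq_or_ne w (min c L) with rfl | hne
  · exact le_rfl
  rcases lt_or_ge 0 a with ha | ha
  · exact (relu_residual_lt hc hL hw ha hne).le
  · have hm : min c L * a ≤ 0 := mul_nonpos_of_nonneg_of_nonpos (lt_min hc hL).le ha
    have hca : c * a ≤ 0 := mul_nonpos_of_nonneg_of_nonpos hc.le ha
    rw [max_eq_left hm]
    nlinarith [le_max_left 0 (w * a)]


/-- The componentwise approximation-training problem for the iResNet with ReLU
activation attains its minimum over `w ∈ [−L, L]` uniquely at `w = min{1 − σ², L}`. -/
theorem relu_componentwise_training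
    (σsq L : ℝ) (hσsq : σsq ∈ Set.Ioo (0 : ℝ) 1) (hL : L ∈ Set.Ioo (0 : ℝ) 1)
    (N : ℕ) (a : Fin N → ℝ) (ha : ∃ i, 0 < a i) :
    (∀ w ∈ Set.Icc (-L) L,
      ∑ i, ((1 - σsq) * a i - max 0 (min (1 - σsq) L * a i)) ^ 2 ≤
        ∑ i, ((1 - σsq) * a i - max 0 (w * a i)) ^ 2) ∧
    (∀ w ∈ Set.Icc (-L) L,
      ∑ i, ((1 - σsq) * a i - max 0 (w * a i)) ^ 2 =
        ∑ i, ((1 - σsq) * a i - max 0 (min (1 - σsq) L * a i)) ^ 2 →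
        w = min (1 - σsq) L) := by
  have hc : 0 < 1 - σsq := sub_pos.mpr hσsq.2
  refine ⟨fun w hw => Finset.sum_le_sum fun i _ => relu_residual_le hc hL.1 hw.2 (a i),
    fun w hw heq => ?_⟩
  by_contra hne
  obtain ⟨i, hi⟩ := ha
  exact heq.not_gt <| Finset.sum_lt_sum (fun j _ => relu_residual_le hc hL.1 hw.2 (a j))
    ⟨i, Finset.mem_univ i, relu_residual_lt hc hL.1 hw.2 hi hne⟩
end

section
/- Let w ∈ (0,1), α ≥ 0 and s ∈ ℝ. Then the equation x̄ − sign(w x̄) · max(0, |w x̄| − α) = s (with sign(0) = 0) has a unique solution x̄ ∈ ℝ, given by x̄ = s if |s| ≤ α/w, and x̄ = sign(s)(|s| − α)/(1−w) if |s| > α/w. -/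
theorem sign_mul_abs_sub_of_pos {t : ℝ} (ht : 0 < t) (α : ℝ) :
    Real.sign t * (|t| - α) = t - α := by
  rw [Real.sign_of_pos ht, abs_of_pos ht, one_mul]

theorem sign_mul_abs_sub_of_neg {t : ℝ} (ht : t < 0) (α : ℝ) :
    Real.sign t * (|t| - α) = t + α := by
  rw [Real.sign_of_neg ht, abs_of_neg ht]
  ring

theorem sign_mul_max_of_abs_le {t α : ℝ} (h : |t| ≤ α) :
    Real.sign t * max 0 (|t| - α) = 0 := by
  rw [max_eq_left (sub_nonpos.2 h), mul_zero]

theorem sign_mul_max_of_lt_abs {t α : ℝ} (h : α < |t|) :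
    Real.sign t * max 0 (|t| - α) = Real.sign t * (|t| - α) := by
  rw [max_eq_right (sub_nonneg.2 h.le)]

/-- Componentwise inversion of the scalar soft-thresholding residual block:
`x̄ − sign(w x̄) max(0, |w x̄| − α) = s` has the unique solution `x̄ = s` if
`|s| ≤ α/w` and `x̄ = sign(s)(|s| − α)/(1−w)` if `|s| > α/w`. -/
theorem soft_thresholding_scalar_inverse
    (w α s : ℝ) (hw : w ∈ Set.Ioo (0 : ℝ) 1) (hα : 0 ≤ α) :
    ∀ xbar : ℝ, xbar - Real.sign (w * xbar) * max 0 (|w * xbar| - α) = s ↔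
      xbar = if |s| ≤ α / w then s else Real.sign s * (|s| - α) / (1 - w) := by
  intro x
  obtain ⟨hw0, hw1⟩ := hw
  have hv : 0 < 1 - w := sub_pos.2 hw1
  have habs : |s| ≤ α / w ↔ |w * s| ≤ α := by
    rw [le_div_iff₀ hw0, abs_mul, abs_of_pos hw0, mul_comm]
  rw [if_congr habs rfl rfl]
  rcases le_or_gt |w * x| α with hx | hx <;> rcases le_or_gt |w * s| α with hs | hs
  · rw [sign_mul_max_of_abs_le hx, if_pos hs, sub_zero]
  · rw [sign_mul_max_of_abs_le hx, if_neg hs.not_ge, sub_zero, eq_div_iff hv.ne']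
    refine iff_of_false (fun h => ?_) (fun h => ?_)
    · exact hs.not_ge (h ▸ hx)
    · have hx' := abs_le.1 hx
      rcases lt_abs.1 hs with hs | hs
      · rw [sign_mul_abs_sub_of_pos (by nlinarith)] at h
        nlinarith
      · rw [sign_mul_abs_sub_of_neg (by nlinarith)] at h
        nlinarith
  · rw [sign_mul_max_of_lt_abs hx, if_pos hs]
    refine iff_of_false (fun h => ?_) (fun h => ?_)
    · have hs' := abs_le.1 hs
      rcases lt_abs.1 hx with hx | hx
      · rw [sign_mul_abs_sub_of_pos (by linarith)] at h
        nlinarith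
      · rw [sign_mul_abs_sub_of_neg (by linarith)] at h
        nlinarith
    · exact hx.not_ge (h ▸ hs)
  · rw [sign_mul_max_of_lt_abs hx, if_neg hs.not_ge, eq_div_iff hv.ne']
    rcases lt_abs.1 hx with hx | hx <;> rcases lt_abs.1 hs with hs | hs
    · rw [sign_mul_abs_sub_of_pos (by linarith), sign_mul_abs_sub_of_pos (by nlinarith)]
      constructor <;> intro h <;> linarith
    · rw [sign_mul_abs_sub_of_pos (by linarith), sign_mul_abs_sub_of_neg (by nlinarith)]
      constructor <;> intro h <;> nlinarith
    · rw [sign_mul_abs_sub_of_neg (by linarith), sign_mul_abs_sub_of_pos (by nlinarith)]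
      constructor <;> intro h <;> nlinarith
    · rw [sign_mul_abs_sub_of_neg (by linarith), sign_mul_abs_sub_of_neg (by nlinarith)]
      constructor <;> intro h <;> linarith
end

section
/- Let σ² ∈ (0,1], α ≥ 0, L ∈ (0,1], and let a_i, i ∈ I, be a nonempty finite family of real numbers with |a_i| > α/L for all i ∈ I. Set p = (Σ_{i∈I} |a_i|²) / (Σ_{i∈I} |a_i|). Then the function w ↦ Σ_{i∈I} ((1 − σ² − w)|a_i| + α)² attains its minimum over the interval [0, L] uniquely at w = min{ α/p + 1 − σ², L }. -/
theorem sum_sq_affine_eq {ι : Type*} [Fintype ι] (b : ι → ℝ) (t α : ℝ) :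
    ∑ i, (t * b i + α) ^ 2 =
      t ^ 2 * ∑ i, b i ^ 2 + 2 * t * α * ∑ i, b i + Fintype.card ι * α ^ 2 := by
  have h : ∀ i, (t * b i + α) ^ 2 = t ^ 2 * b i ^ 2 + 2 * t * α * b i + α ^ 2 :=
    fun i => by ring
  simp [h, Finset.sum_add_distrib, Finset.mul_sum]

/-- Quadratic growth of the least squares objective away from its constrained minimizer. -/
theorem sum_sq_affine_add_le {ι : Type*} [Fintype ι] (b : ι → ℝ) {c α L q w : ℝ}
    (hq : q * ∑ i, b i ^ 2 = α * ∑ i, b i) (hw : w ≤ L) :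
    ∑ i, ((c - min (q + c) L) * b i + α) ^ 2 + (∑ i, b i ^ 2) * (w - min (q + c) L) ^ 2 ≤
      ∑ i, ((c - w) * b i + α) ^ 2 := by
  have hA : 0 ≤ ∑ i, b i ^ 2 := Finset.sum_nonneg fun i _ => sq_nonneg _
  rw [sum_sq_affine_eq, sum_sq_affine_eq]
  generalize ∑ i, b i ^ 2 = A at *
  generalize ∑ i, b i = B at *
  have key : 0 ≤ A * ((w - min (q + c) L) * (min (q + c) L - (q + c))) := by
    refine mul_nonneg hA ?_
    rcases le_total (q + c) L with h | h
    · simp [min_eq_left h]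
    · rw [min_eq_right h]
      exact mul_nonneg_of_nonpos_of_nonpos (by linarith) (by linarith)
  linear_combination 2 * key - 2 * (w - min (q + c) L) * hq


/-- The reduced componentwise approximation-training problem for the iResNet with
soft-thresholding activation attains its minimum over `w ∈ [0, L]` uniquely at
`w = min{α/p + 1 − σ², L}` with `p = (Σ|aᵢ|²)/(Σ|aᵢ|)`. -/
theorem soft_thresholding_componentwise_training
    (σsq α L : ℝ) (hσsq : σsq ∈ Set.Ioc (0 : ℝ) 1) (hα : 0 ≤ α)
    (hL : L ∈ Set.Ioc (0 : ℝ) 1)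
    (N : ℕ) (hN : 0 < N) (a : Fin N → ℝ) (ha : ∀ i, α / L < |a i|) :
    (∀ w ∈ Set.Icc (0 : ℝ) L,
      ∑ i, ((1 - σsq - min (α / ((∑ i, |a i| ^ 2) / (∑ i, |a i|)) + 1 - σsq) L) * |a i| + α) ^ 2
        ≤ ∑ i, ((1 - σsq - w) * |a i| + α) ^ 2) ∧
    (∀ w ∈ Set.Icc (0 : ℝ) L,
      ∑ i, ((1 - σsq - w) * |a i| + α) ^ 2 =
        ∑ i, ((1 - σsq - min (α / ((∑ i, |a i| ^ 2) / (∑ i, |a i|)) + 1 - σsq) L) * |a i| + α) ^ 2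
        → w = min (α / ((∑ i, |a i| ^ 2) / (∑ i, |a i|)) + 1 - σsq) L) := by
  have : Nonempty (Fin N) := ⟨⟨0, hN⟩⟩
  have hpos : ∀ i, 0 < |a i| := fun i => (div_nonneg hα hL.1.le).trans_lt (ha i)
  have hB : 0 < ∑ i, |a i| := Finset.sum_pos (fun i _ => hpos i) Finset.univ_nonempty
  have hA : 0 < ∑ i, |a i| ^ 2 :=
    Finset.sum_pos (fun i _ => pow_pos (hpos i) 2) Finset.univ_nonempty
  have hq : α / ((∑ i, |a i| ^ 2) / (∑ i, |a i|)) * ∑ i, |a i| ^ 2 = α * ∑ i, |a i| := by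
    field_simp
  rw [add_sub_assoc]
  have growth : ∀ w ∈ Set.Icc (0 : ℝ) L, _ := fun w hw =>
    sum_sq_affine_add_le (fun i => |a i|) (c := 1 - σsq) hq hw.2
  refine ⟨fun w hw => ?_, fun w hw h => ?_⟩
  · exact le_of_add_le_of_nonneg_left (growth w hw) (mul_nonneg hA.le (sq_nonneg _))
  · have hle := growth w hw
    rw [h, add_le_iff_nonpos_right] at hle
    have hsq := nonpos_of_mul_nonpos_right hle hA
    exact sub_eq_zero.1 (pow_eq_zero_iff two_ne_zero |>.1 (le_antisymm hsq (sq_nonneg _)))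
end

section
/- Let X be a real Hilbert space with a Hilbert (orthonormal) basis (v_j)_{j∈ℕ}, let L ≥ 0, and for each j let f_j : ℝ → ℝ be Lipschitz continuous with Lipschitz constant at most L and assume Σ_{j∈ℕ} f_j(0)² < ∞. Then for every x ∈ X the family (f_j(⟨x, v_j⟩))_{j∈ℕ} is square-summable, so that f(x) := Σ_{j∈ℕ} f_j(⟨x, v_j⟩) v_j defines a map f : X → X, and f is Lipschitz continuous with Lipschitz constant at most L, i.e., ‖f(x) − f(y)‖ ≤ L ‖x − y‖ for all x, y ∈ X. -/
open scoped RealInnerProductSpace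

namespace HilbertBasis

variable {ι X : Type*} [NormedAddCommGroup X] [InnerProductSpace ℝ X]

/-- Parseval's identity for a real Hilbert basis. -/
theorem hasSum_sq_inner (b : HilbertBasis ι ℝ X) (x : X) :
    HasSum (fun i => ⟪x, b i⟫ ^ 2) (‖x‖ ^ 2) := by
  have h := b.hasSum_inner_mul_inner x x
  rw [real_inner_self_eq_norm_sq] at h
  simpa only [real_inner_comm x, ← sq] using h

/-- The coefficients of a convergent expansion in a Hilbert basis are the inner products. -/
theorem inner_eq_of_hasSum (b : HilbertBasis ι ℝ X) {c : ι → ℝ} {z : X}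
    (h : HasSum (fun i => c i • b i) z) (i : ι) : ⟪z, b i⟫ = c i := by
  have h₁ : HasSum (fun j => ⟪b i, c j • b j⟫) ⟪b i, z⟫ := h.mapL (innerSL ℝ (b i))
  have h₂ : HasSum (fun j => ⟪b i, c j • b j⟫) ⟪b i, c i • b i⟫ :=
    hasSum_single i fun j hj => by
      rw [real_inner_smul_right, b.orthonormal.inner_eq_zero hj.symm, mul_zero]
  rw [real_inner_comm, h₁.unique h₂, real_inner_smul_right, real_inner_self_eq_norm_sq,
    b.orthonormal.norm_eq_one, one_pow, mul_one]

/-- A square-summable family is the coefficient family of some vector (Riesz-Fischer). -/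
theorem exists_hasSum_of_summable_sq (b : HilbertBasis ι ℝ X) {c : ι → ℝ}
    (hc : Summable fun i => c i ^ 2) : ∃ z, HasSum (fun i => c i • b i) z := by
  have hmem : Memℓp c 2 := memℓp_gen (by simpa using hc)
  exact ⟨_, b.hasSum_repr_symm ⟨c, hmem⟩⟩

end HilbertBasis

/-- Diagonal architecture: if each scalar subnetwork `f_j` is `L`-Lipschitz and
`(f_j(0))_j` is square-summable, then `f(x) = Σ_j f_j(⟨x, v_j⟩) v_j` is a well-defined
map `X → X` and is `L`-Lipschitz. -/
theorem diagonal_architecture_lipschitz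
    {X : Type*} [NormedAddCommGroup X] [InnerProductSpace ℝ X] [CompleteSpace X]
    (b : HilbertBasis ℕ ℝ X)
    (L : ℝ) (hL : 0 ≤ L)
    (fj : ℕ → ℝ → ℝ)
    (hfj : ∀ j, ∀ s t : ℝ, |fj j s - fj j t| ≤ L * |s - t|)
    (hf0 : Summable fun j => fj j 0 ^ 2) :
    (∀ x : X, Summable fun j => fj j ⟪x, b j⟫ ^ 2) ∧
    (∀ x : X, ∃ Fx : X, HasSum (fun j => fj j ⟪x, b j⟫ • b j) Fx) ∧
    (∀ x y Fx Fy : X, HasSum (fun j => fj j ⟪x, b j⟫ • b j) Fx →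
      HasSum (fun j => fj j ⟪y, b j⟫ • b j) Fy → ‖Fx - Fy‖ ≤ L * ‖x - y‖) := by
  have hsum (x : X) : Summable fun j => fj j ⟪x, b j⟫ ^ 2 := by
    refine .of_nonneg_of_le (fun j => sq_nonneg _) (fun j => ?_)
      (((b.hasSum_sq_inner x).summable.mul_left (2 * L ^ 2)).add (hf0.mul_left 2))
    have h := sq_le_sq' (neg_le_of_abs_le (hfj j ⟪x, b j⟫ 0)) (le_of_abs_le (hfj j ⟪x, b j⟫ 0))
    rw [sub_zero, mul_pow, sq_abs] at h
    nlinarith [sq_nonneg (fj j ⟪x, b j⟫ - 2 * fj j 0)]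
  refine ⟨hsum, fun x => b.exists_hasSum_of_summable_sq (hsum x), fun x y Fx Fy hx hy => ?_⟩
  refine (sq_le_sq₀ (norm_nonneg _) (by positivity)).1 ?_
  rw [mul_pow]
  refine hasSum_le (fun j => ?_) (b.hasSum_sq_inner (Fx - Fy))
    ((b.hasSum_sq_inner (x - y)).mul_left (L ^ 2))
  rw [inner_sub_left, inner_sub_left, b.inner_eq_of_hasSum hx, b.inner_eq_of_hasSum hy,
    ← sq_abs, ← sq_abs (⟪x, b j⟫ - _), ← mul_pow]
  exact pow_le_pow_left₀ (abs_nonneg _) (hfj j _ _) 2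
end
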